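/- Let 0 ≤ t ≤ s < ∞, ω ∈ Ω^t and r ∈ [s,∞]. Then for every A ∈ F^t_r the set A^{s,ω} belongs to F^s_r, and for every Ã ∈ F^s_r the set ω⊗_s Ã belongs to F^t_r. -/

import Mathlib

open MeasureTheory ProbabilityTheory Set

noncomputable section

/-- Euclidean space ℝ^n. -/
abbrev Euc (n : ℕ) := EuclideanSpace ℝ (Fin n)

/-- The canonical path space `Ω^t`: continuous paths on `[t,∞)` starting from `0` at time `t`
(encoded as continuous functions on `ℝ` vanishing on `(-∞,t]`). -/
def CPath (d : ℕ) (t : ℝ) : Type :=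
  {ω : ℝ → Euc d // Continuous ω ∧ ∀ r ≤ t, ω r = 0}

namespace CPath

/-- the coordinate (canonical) process `W^t`. -/
def W {d : ℕ} {t : ℝ} (r : ℝ) (ω : CPath d t) : Euc d := ω.1 r

/-- the raw filtration `F^t_s = σ(W^t_r ; r ∈ [t,s])`. -/
def raw (d : ℕ) (t s : ℝ) : MeasurableSpace (CPath d t) :=
  ⨆ r ∈ Set.Icc t s, MeasurableSpace.comap (fun ω : CPath d t => ω.1 r) inferInstance

/-- the total raw σ-field `F^t = σ(W^t_r ; r ∈ [t,∞))`. -/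
def rawInf (d : ℕ) (t : ℝ) : MeasurableSpace (CPath d t) :=
  ⨆ r ∈ Set.Ici t, MeasurableSpace.comap (fun ω : CPath d t => ω.1 r) inferInstance

/-- concatenation `ω ⊗_s ϖ` of paths at time `s`. -/
def concat {d : ℕ} {t s : ℝ} (hts : t ≤ s) (ω : CPath d t) (ϖ : CPath d s) : CPath d t :=
  ⟨fun r => ω.1 (min r s) + ϖ.1 r,
    (ω.2.1.comp (continuous_id.min continuous_const)).add ϖ.2.1,
    fun r hr => by
      have h1 : ω.1 (min r s) = 0 := ω.2.2 _ (le_trans (min_le_left _ _) hr)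
      have h2 : ϖ.1 r = 0 := ϖ.2.2 _ (hr.trans hts)
      simp [h1, h2]⟩

/-- the set `A^{s,ω} = {ϖ ∈ Ω^s : ω ⊗_s ϖ ∈ A}`. -/
def shSet {d : ℕ} {t s : ℝ} (hts : t ≤ s) (ω : CPath d t) (A : Set (CPath d t)) :
    Set (CPath d s) := {ϖ | concat hts ω ϖ ∈ A}

/-- the shifted random variable / process `ξ^{s,ω}`. -/
def shRV {d : ℕ} {t s : ℝ} {γ : Type*} (hts : t ≤ s) (ω : CPath d t) (ξ : CPath d t → γ) :
    CPath d s → γ := fun ϖ => ξ (concat hts ω ϖ)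

/-- `P` is the Wiener measure on `(Ω^t, F^t)`, i.e. the coordinate process is a standard
`d`-dimensional Brownian motion on `[t,∞)` under `P`. -/
def IsBrownian (d : ℕ) (t : ℝ) (P : @Measure (CPath d t) (rawInf d t)) : Prop :=
  @IsProbabilityMeasure _ (rawInf d t) P ∧
  (∀ u v : ℝ, t ≤ u → u ≤ v →
    @ProbabilityTheory.Indep _
      (MeasurableSpace.comap (fun ω : CPath d t => ω.1 v - ω.1 u) inferInstance)
      (raw d t u) (rawInf d t) P) ∧
  (∀ u v : ℝ, t ≤ u → u ≤ v → ∀ i : Fin d,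
    @Measure.map _ _ (rawInf d t) _ (fun ω : CPath d t => ω.1 v i - ω.1 u i) P
      = gaussianReal 0 (Real.toNNReal (v - u))) ∧
  (∀ u v : ℝ, t ≤ u → u ≤ v →
    @ProbabilityTheory.iIndepFun (CPath d t) (Fin d) (rawInf d t) (fun _ => ℝ)
      (fun _ => (inferInstance : MeasurableSpace ℝ))
      (fun (i : Fin d) (ω : CPath d t) => ω.1 v i - ω.1 u i) P)

/-- the collection `𝒩^t` of `P_t`-null sets. -/
def nulls {d : ℕ} {t : ℝ} (P : @Measure (CPath d t) (rawInf d t)) : Set (Set (CPath d t)) :=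
  {N | ∃ A, MeasurableSet[rawInf d t] A ∧ P A = 0 ∧ N ⊆ A}

/-- the augmented filtration `F̄^t_s = σ(F^t_s ∪ 𝒩^t)`. -/
def aug {d : ℕ} {t : ℝ} (P : @Measure (CPath d t) (rawInf d t)) (s : ℝ) :
    MeasurableSpace (CPath d t) :=
  raw d t s ⊔ MeasurableSpace.generateFrom (nulls P)

/-- the augmented σ-field `F̄^t = σ(F^t ∪ 𝒩^t)`. -/
def augInf {d : ℕ} {t : ℝ} (P : @Measure (CPath d t) (rawInf d t)) :
    MeasurableSpace (CPath d t) :=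
  rawInf d t ⊔ MeasurableSpace.generateFrom (nulls P)

/-- `τ ∈ 𝒯̄^t` : an `F̄^t`-stopping time with values in `[t,∞)`. -/
def IsStopTime {d : ℕ} {t : ℝ} (P : @Measure (CPath d t) (rawInf d t))
    (τ : CPath d t → ℝ) : Prop :=
  (∀ ω, t ≤ τ ω) ∧ ∀ r, t ≤ r → MeasurableSet[aug P r] {ω | τ ω ≤ r}

end CPath
namespace CPath

/-- The σ-field generated by the coordinates at the times in `I`. -/
@[reducible] def coordSigma (d : ℕ) (t : ℝ) (I : Set ℝ) : MeasurableSpace (CPath d t) :=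
  ⨆ r ∈ I, MeasurableSpace.comap (fun ω : CPath d t => ω.1 r) inferInstance

theorem measurable_coord {d : ℕ} {t : ℝ} {I : Set ℝ} {u : ℝ} (hu : u ∈ I ∨ u ≤ t) :
    Measurable[coordSigma d t I] (fun ω : CPath d t => ω.1 u) := by
  rcases hu with hu | hu
  · exact (comap_measurable _).mono
      (le_iSup₂_of_le (f := fun r (_ : r ∈ I) =>
        MeasurableSpace.comap (fun ω : CPath d t => ω.1 r) inferInstance) u hu le_rfl) le_rfl
  · have h : (fun ω : CPath d t => ω.1 u) = fun _ => 0 := funext fun ω => ω.2.2 u hu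
    rw [h]
    exact @measurable_const _ _ _ (coordSigma d t I) _

theorem measurable_of_coord {d : ℕ} {t : ℝ} {I : Set ℝ} {Ω : Type*} [MeasurableSpace Ω]
    {f : Ω → CPath d t} (hf : ∀ u ∈ I, Measurable fun x => (f x).1 u) :
    @Measurable _ _ _ (coordSigma d t I) f := by
  rw [measurable_iff_comap_le, coordSigma]
  simp only [MeasurableSpace.comap_iSup, MeasurableSpace.comap_comp]
  exact iSup₂_le fun u hu => (hf u hu).comap_le

/-- The increments after time `s` of a path started at time `t`. -/
def shift {d : ℕ} {t : ℝ} (s : ℝ) (η : CPath d t) : CPath d s :=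
  ⟨fun r => η.1 r - η.1 (min r s),
    η.2.1.sub (η.2.1.comp (continuous_id.min continuous_const)),
    fun r hr => by simp [min_eq_left hr]⟩

theorem shift_concat {d : ℕ} {t s : ℝ} (hts : t ≤ s) (ω : CPath d t) (ϖ : CPath d s) :
    shift s (concat hts ω ϖ) = ϖ := by
  refine Subtype.ext (funext fun r => ?_)
  have h : ϖ.1 (min r s) = 0 := ϖ.2.2 _ (min_le_right _ _)
  simp [shift, concat, h]

theorem concat_shift {d : ℕ} {t s : ℝ} (hts : t ≤ s) (ω η : CPath d t)
    (h : ∀ q : ℚ, η.1 (min q s) = ω.1 (min q s)) : concat hts ω (shift s η) = η := by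
  have hmin : (fun r : ℝ => η.1 (min r s)) = fun r => ω.1 (min r s) :=
    Rat.denseRange_cast.equalizer (η.2.1.comp (continuous_id.min continuous_const))
      (ω.2.1.comp (continuous_id.min continuous_const)) (funext h)
  refine Subtype.ext (funext fun r => ?_)
  simp [shift, concat, ← congrFun hmin r]

theorem image_concat {d : ℕ} {t s : ℝ} (hts : t ≤ s) (ω : CPath d t) (A : Set (CPath d s)) :
    concat hts ω '' A =
      shift s ⁻¹' A ∩ ⋂ q : ℚ, {η : CPath d t | η.1 (min q s) = ω.1 (min q s)} := by
  ext η
  simp only [mem_image, mem_inter_iff, mem_preimage, mem_iInter, mem_ofPred_eq]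
  constructor
  · rintro ⟨ϖ, hϖ, rfl⟩
    refine ⟨by rwa [shift_concat], fun q => ?_⟩
    have h : ϖ.1 (min q s) = 0 := ϖ.2.2 _ (min_le_right _ _)
    simp [concat, h]
  · rintro ⟨hA, h⟩
    exact ⟨shift s η, hA, concat_shift hts ω η h⟩

theorem measurableSet_shSet {d : ℕ} {t s : ℝ} (hts : t ≤ s) (ω : CPath d t) {I J : Set ℝ}
    (hIJ : ∀ u ∈ I, s ≤ u → u ∈ J) {A : Set (CPath d t)}
    (hA : MeasurableSet[coordSigma d t I] A) :
    MeasurableSet[coordSigma d s J] (shSet hts ω A) := by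
  let := coordSigma d s J
  refine measurable_of_coord (f := concat hts ω) (fun u hu => ?_) hA
  exact (measurable_coord ((le_total s u).imp (hIJ u hu) id)).const_add (ω.1 (min u s))

theorem measurableSet_image_concat {d : ℕ} {t s : ℝ} (hts : t ≤ s) (ω : CPath d t)
    {I J : Set ℝ} (hJI : J ⊆ I) (hI : Icc t s ⊆ I) {A : Set (CPath d s)}
    (hA : MeasurableSet[coordSigma d s J] A) :
    MeasurableSet[coordSigma d t I] (concat hts ω '' A) := by
  let := coordSigma d t I
  have hmin (u : ℝ) : Measurable fun η : CPath d t => η.1 (min u s) :=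
    measurable_coord ((le_total t (min u s)).imp (fun h => hI ⟨h, min_le_right _ _⟩) id)
  rw [image_concat]
  refine MeasurableSet.inter (measurable_of_coord (f := shift s) (fun u hu => ?_) hA)
    (MeasurableSet.iInter fun q => hmin q (measurableSet_singleton _))
  exact (measurable_coord (Or.inl (hJI hu))).sub (hmin u)

end CPath

open CPath in
/-- Lemma 3.2: for `r ∈ [s,∞]`, the operation `A ↦ A^{s,ω}` maps `F^t_r`-measurable sets to
`F^s_r`-measurable sets, and `Ã ↦ ω ⊗_s Ã` maps `F^s_r`-measurable sets to
`F^t_r`-measurable sets (the case `r = ∞` being the statement for `F^t`, `F^s`). -/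
theorem stmt5 {d : ℕ} {t s : ℝ} (h0t : 0 ≤ t) (hts : t ≤ s) (ω : CPath d t) :
    (∀ r, s ≤ r →
      (∀ A : Set (CPath d t), MeasurableSet[raw d t r] A →
        MeasurableSet[raw d s r] (shSet hts ω A)) ∧
      (∀ A' : Set (CPath d s), MeasurableSet[raw d s r] A' →
        MeasurableSet[raw d t r] (concat hts ω '' A'))) ∧
    ((∀ A : Set (CPath d t), MeasurableSet[rawInf d t] A →
        MeasurableSet[rawInf d s] (shSet hts ω A)) ∧
     (∀ A' : Set (CPath d s), MeasurableSet[rawInf d s] A' →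
        MeasurableSet[rawInf d t] (concat hts ω '' A'))) := by
  exact ⟨fun r hr =>
    ⟨fun A hA => measurableSet_shSet (I := Icc t r) (J := Icc s r) hts ω
        (fun u hu hsu => ⟨hsu, hu.2⟩) hA,
      fun A' hA => measurableSet_image_concat (I := Icc t r) (J := Icc s r) hts ω
        (Icc_subset_Icc_left hts) (Icc_subset_Icc_right hr) hA⟩,
    fun A hA => measurableSet_shSet (I := Ici t) (J := Ici s) hts ω (fun u _ hsu => hsu) hA,
    fun A' hA => measurableSet_image_concat (I := Ici t) (J := Ici s) hts ω
      (Ici_subset_Ici.2 hts) Icc_subset_Ici_self hA⟩
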